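/- (Theorem, the packed pattern is the worst-case pattern.) Let K be a positive natural number, C ≥ 0 a real execution requirement, and D, T real numbers with 0 < D ≤ T. Let σ : Fin K → {0,1} be any multiframe execution pattern and σ^p its packed pattern. If the packed pattern is schedulable in the demand-bound sense, i.e., D̂̂(σ^p, t) ≤ t for all real t > 0, then σ is also schedulable, i.e., D̂̂(σ, t) ≤ t for all real t > 0. -/

import Mathlib

/-- `ℓ(σ)`: number of nonzero entries of a multiframe execution pattern. -/
def numNonzero {K : ℕ} (σ : Fin K → ℕ) : ℕ :=
  (Finset.univ.filter fun j => σ j = 1).card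

/-- The packed pattern `σᵖ` of a pattern `σ`: ones at indices `j < ℓ(σ)`, zeros after. -/
def packedOf {K : ℕ} (σ : Fin K → ℕ) : Fin K → ℕ :=
  fun j => if (j : ℕ) < numNonzero σ then 1 else 0

/-- The demand bound function with pattern:
`D̂̂(σ,t) = s(t)·ℓ(σ)·C + max_{0 ≤ c ≤ K−1} ∑_{j=c}^{c+max(0,nb(t))−1} σ(j mod K)·C`,
where `s(t) = ⌊t/(K·T)⌋` and `nb(t) = ⌊((t − s(t)·K·T) − D)/T⌋ + 1`. -/
noncomputable def dbfPattern (K : ℕ) (hK : 0 < K) (σ : Fin K → ℕ)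
    (C D T t : ℝ) : ℝ :=
  let s : ℤ := ⌊t / (K * T)⌋
  let nb : ℤ := ⌊((t - s * (K * T)) - D) / T⌋ + 1
  (s : ℝ) * (numNonzero σ) * C +
    (Finset.range K).sup' (Finset.nonempty_range_iff.mpr hK.ne')
      (fun c => ∑ j ∈ Finset.range (max 0 nb).toNat,
        (σ ⟨(c + j) % K, Nat.mod_lt _ hK⟩ : ℝ) * C)

theorem numNonzero_le {K : ℕ} (σ : Fin K → ℕ) : numNonzero σ ≤ K := by
  simpa [numNonzero] using
    Finset.card_filter_le (Finset.univ : Finset (Fin K)) fun j => σ j = 1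

theorem numNonzero_packedOf {K : ℕ} (σ : Fin K → ℕ) :
    numNonzero (packedOf σ) = numNonzero σ := by
  have h : numNonzero (packedOf σ) =
      (Finset.univ.filter fun j : Fin K => (j : ℕ) < numNonzero σ).card := by
    rw [numNonzero]
    simp [packedOf]
  rw [h, Fin.card_filter_val_lt, min_eq_right (numNonzero_le σ)]

theorem numNonzero_eq_sum {K : ℕ} {σ : Fin K → ℕ} (hσ : ∀ j, σ j = 0 ∨ σ j = 1) :
    numNonzero σ = ∑ j, σ j := by
  rw [numNonzero, Finset.card_filter]
  refine Finset.sum_congr rfl fun j _ => ?_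
  rcases hσ j with h | h <;> simp [h]

/-- A cyclic window of length `n ≤ K` contains at most `min n ℓ(σ)` ones. -/
theorem window_sum_le {K : ℕ} (hK : 0 < K) {σ : Fin K → ℕ} (hσ : ∀ j, σ j = 0 ∨ σ j = 1)
    {n : ℕ} (hn : n ≤ K) (c : ℕ) :
    ∑ j ∈ Finset.range n, σ ⟨(c + j) % K, Nat.mod_lt _ hK⟩ ≤ min n (numNonzero σ) := by
  refine le_min ?_ ?_
  · calc ∑ j ∈ Finset.range n, σ ⟨(c + j) % K, Nat.mod_lt _ hK⟩
        ≤ ∑ _j ∈ Finset.range n, 1 :=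
          Finset.sum_le_sum fun j _ => by
            rcases hσ ⟨(c + j) % K, Nat.mod_lt _ hK⟩ with h | h <;> simp [h]
      _ = n := by simp
  · have hinj : Set.InjOn (fun j : ℕ => (⟨(c + j) % K, Nat.mod_lt _ hK⟩ : Fin K))
        (Finset.range n) := by
      intro a ha b hb hab
      have ha' : a < K := (Finset.mem_range.mp ha).trans_le hn
      have hb' : b < K := (Finset.mem_range.mp hb).trans_le hn
      have hmod : c + a ≡ c + b [MOD K] := congrArg Fin.val hab
      exact (Nat.ModEq.add_left_cancel' c hmod).eq_of_lt_of_lt ha' hb'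
    rw [numNonzero_eq_sum hσ, ← Finset.sum_image (f := σ) hinj]
    exact Finset.sum_le_sum_of_subset (Finset.subset_univ _)

/-- The initial window of length `n ≤ K` of the packed pattern contains `min n ℓ(σ)` ones. -/
theorem packedOf_initial_sum {K : ℕ} (hK : 0 < K) (σ : Fin K → ℕ) {n : ℕ} (hn : n ≤ K) :
    ∑ j ∈ Finset.range n, packedOf σ ⟨(0 + j) % K, Nat.mod_lt _ hK⟩ =
      min n (numNonzero σ) := by
  have h : ∀ j ∈ Finset.range n, packedOf σ ⟨(0 + j) % K, Nat.mod_lt _ hK⟩ =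
      if j < numNonzero σ then 1 else 0 := fun j hj => by
    have hjK : j < K := (Finset.mem_range.mp hj).trans_le hn
    simp [packedOf, Nat.mod_eq_of_lt hjK]
  rw [Finset.sum_congr rfl h, ← Finset.card_filter]
  have hfilter : (Finset.range n).filter (· < numNonzero σ) =
      Finset.range (min n (numNonzero σ)) := by
    ext j
    simp
  rw [hfilter, Finset.card_range]

/-- Within one hyperperiod `K * T` at most `K` jobs have both release and deadline. -/
theorem floor_jobs_le {K : ℕ} (hK : 0 < K) {D T : ℝ} (hD : 0 < D) (hT : 0 < T) (t : ℝ) :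
    ⌊((t - ⌊t / (K * T)⌋ * (K * T)) - D) / T⌋ + 1 ≤ (K : ℤ) := by
  have hKT : (0 : ℝ) < K * T := mul_pos (Nat.cast_pos.mpr hK) hT
  have ht : t < (⌊t / (K * T)⌋ + 1) * (K * T) :=
    (div_lt_iff₀ hKT).mp (Int.lt_floor_add_one _)
  rw [Int.add_one_le_iff, Int.floor_lt, div_lt_iff₀ hT]
  push_cast
  linarith

theorem dbfPattern_le_packedOf {K : ℕ} (hK : 0 < K) {σ : Fin K → ℕ}
    (hσ : ∀ j, σ j = 0 ∨ σ j = 1) {C D T : ℝ} (hC : 0 ≤ C) (hD : 0 < D) (hT : 0 < T) (t : ℝ) :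
    dbfPattern K hK σ C D T t ≤ dbfPattern K hK (packedOf σ) C D T t := by
  unfold dbfPattern
  simp only [numNonzero_packedOf]
  have hnb := floor_jobs_le hK hD hT t
  generalize ⌊((t - ⌊t / (K * T)⌋ * (K * T)) - D) / T⌋ + 1 = nb at hnb ⊢
  have hn : (max 0 nb).toNat ≤ K := by omega
  refine add_le_add le_rfl ?_
  refine Finset.sup'_le _ _ fun c _ => ?_
  refine le_trans ?_ (Finset.le_sup' _ (Finset.mem_range.mpr hK))
  simp only [← Finset.sum_mul]
  gcongr ?_ * C
  exact_mod_cast (window_sum_le hK hσ hn c).trans_eq (packedOf_initial_sum hK σ hn).symm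

/-- **Theorem: the packed pattern is the worst-case pattern.**
If the packed pattern `σᵖ` of `σ` is schedulable in the demand-bound sense
(`D̂̂(σᵖ, t) ≤ t` for all `t > 0`), then so is `σ`. -/
theorem packed_worst_case_pattern
    (K : ℕ) (hK : 0 < K) (σ : Fin K → ℕ) (hσ : ∀ j, σ j = 0 ∨ σ j = 1)
    (C D T : ℝ) (hC : 0 ≤ C) (hD : 0 < D) (hDT : D ≤ T)
    (hsched : ∀ t : ℝ, 0 < t → dbfPattern K hK (packedOf σ) C D T t ≤ t) :
    ∀ t : ℝ, 0 < t → dbfPattern K hK σ C D T t ≤ t := by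
  intro t ht
  exact (dbfPattern_le_packedOf hK hσ hC hD (hD.trans_le hDT) t).trans (hsched t ht)
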